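/- Let K be a compact Hausdorff space, k ≥ 1 an integer, and let P be an orthogonally additive continuous k-homogeneous polynomial on C(K). Then there exists a complex regular Borel measure μ on K such that P(x) = ∫_K x(t)^k dμ(t) for all x ∈ C(K). -/

import Mathlib

open MeasureTheory Filter Topology

/-- `f` is orthogonally additive when it is additive on orthogonal pairs. -/
def IsOrthAdd {K : Type*} [TopologicalSpace K] [CompactSpace K]
    (f : C(K, ℂ) → ℂ) : Prop :=
  ∀ x y : C(K, ℂ), x * y = 0 → f (x + y) = f x + f y

/-- `P` is a continuous `k`-homogeneous polynomial on `C(K, ℂ)`. -/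
def IsHomogPoly {K : Type*} [TopologicalSpace K] [CompactSpace K]
    (k : ℕ) (P : C(K, ℂ) → ℂ) : Prop :=
  ∃ M : ContinuousMultilinearMap ℂ (fun _ : Fin k => C(K, ℂ)) ℂ,
    ∀ x : C(K, ℂ), P x = M (fun _ => x)

set_option linter.unusedSectionVars false
section AlgPart

lemma toggle_sum {ι : Type*} [Fintype ι] [DecidableEq ι] (G : Finset ι → ℂ) (j : ι)
    (hG : ∀ S, j ∉ S → G (insert j S) = G S) : ∑ S : Finset ι, (-1 : ℂ) ^ S.card * G S = 0 := by
  have h := Finset.sum_powerset_insert (Finset.notMem_erase j Finset.univ)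
    (fun S : Finset ι => (-1 : ℂ) ^ S.card * G S)
  rw [Finset.insert_erase (Finset.mem_univ j), Finset.powerset_univ] at h
  rw [h, ← Finset.sum_add_distrib]
  refine Finset.sum_eq_zero fun S hS => ?_
  have hj : j ∉ S := fun hjS => by
    have := Finset.mem_powerset.1 hS hjS
    simp at this
  rw [hG S hj, Finset.card_insert_of_notMem hj]
  ring

lemma polarize {E : Type*} [AddCommGroup E] [Module ℂ E] {k : ℕ}
    (M : MultilinearMap ℂ (fun _ : Fin k => E) ℂ) (z : Fin k → E) :
    ∑ S : Finset (Fin k), (-1 : ℂ) ^ S.card * M (fun _ => ∑ i ∈ S, z i) =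
      (-1) ^ k * ∑ σ : Equiv.Perm (Fin k), M (fun i => z (σ i)) := by
  classical
  have h1 : ∀ S : Finset (Fin k), M (fun _ => ∑ i ∈ S, z i) =
      ∑ r : Fin k → Fin k, (if ∀ i, r i ∈ S then 1 else 0) * M (fun i => z (r i)) := by
    intro S
    rw [M.map_sum_finset (fun _ j => z j) (fun _ => S)]
    simp only [ite_mul, one_mul, zero_mul, ← Finset.sum_filter]
    congr 1
    ext r
    simp
  simp only [h1, Finset.mul_sum]
  rw [Finset.sum_comm]
  symm
  refine Finset.sum_of_injOn (fun σ : Equiv.Perm (Fin k) => (σ : Fin k → Fin k)) ?_ ?_ ?_ ?_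
  · intro a _ b _ h
    exact DFunLike.coe_injective h
  · intro a _; simp
  · intro r _ hr
    have hns : ¬ Function.Surjective r := by
      intro hs
      apply hr
      exact ⟨Equiv.ofBijective r (Finite.surjective_iff_bijective.1 hs), by simp, rfl⟩
    simp only [Function.Surjective, not_forall, not_exists] at hns
    obtain ⟨j, hj⟩ := hns
    have := toggle_sum (fun S => (if ∀ i, r i ∈ S then 1 else 0) * M (fun i => z (r i))) j (by
      intro S _
      have : ∀ i, r i ∈ insert j S ↔ r i ∈ S := fun i => by simp [hj i]
      simp only [this])
    exact this
  · intro σ _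
    rw [Finset.sum_eq_single Finset.univ]
    · simp
    · intro S _ hS
      have : ¬ ∀ i, σ i ∈ S := fun h => hS (by
        ext i; simpa using h (σ.symm i))
      simp [this]
    · simp

variable {K : Type*} [TopologicalSpace K] [CompactSpace K] {k : ℕ}

def OrthVanish (N : ContinuousMultilinearMap ℂ (fun _ : Fin k => C(K, ℂ)) ℂ) : Prop :=
  ∀ (z : Fin k → C(K, ℂ)) (I : Set (Fin k)) (p q : Fin k), p ∈ I → q ∉ I →
    (∀ i j, i ∈ I → j ∉ I → z i * z j = 0) → N z = 0

lemma exists_symm {P : C(K, ℂ) → ℂ} (hP : ∃ M : ContinuousMultilinearMap ℂ (fun _ : Fin k => C(K, ℂ)) ℂ, ∀ x, P x = M (fun _ => x)) 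
  (hOA : IsOrthAdd P) :
    ∃ N : ContinuousMultilinearMap ℂ (fun _ : Fin k => C(K, ℂ)) ℂ,
      (∀ x, N (fun _ => x) = (k.factorial : ℂ) * P x) ∧ OrthVanish N := by
  classical
  obtain ⟨M, hM⟩ := hP
  have hN : ∀ z, (∑ σ : Equiv.Perm (Fin k), M.domDomCongr σ) z =
      ∑ σ : Equiv.Perm (Fin k), M (fun i => z (σ i)) := by
    intro z
    rw [_root_.sum_apply]; rfl
  refine ⟨∑ σ : Equiv.Perm (Fin k), M.domDomCongr σ, ?_, ?_⟩
  · intro x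
    rw [hN]
    simp [hM, Fintype.card_perm]
  · intro z I p q hp hq hz
    rw [hN]
    have h := polarize M.toMultilinearMap z
    have h0 : ∑ S : Finset (Fin k), (-1 : ℂ) ^ S.card * P (∑ i ∈ S, z i) = 0 := by
      have hsplit : ∀ S : Finset (Fin k), P (∑ i ∈ S, z i) =
          P (∑ i ∈ S with i ∈ I, z i) + P (∑ i ∈ S with i ∉ I, z i) := by
        intro S
        rw [← hOA, Finset.sum_filter_add_sum_filter_not]
        rw [Finset.sum_mul_sum]
        refine Finset.sum_eq_zero fun i hi => Finset.sum_eq_zero fun j hj => ?_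
        exact hz i j (Finset.mem_filter.1 hi).2 (Finset.mem_filter.1 hj).2
      rw [Finset.sum_congr rfl (fun S _ => by rw [hsplit S, mul_add]), Finset.sum_add_distrib]
      rw [toggle_sum (fun S => P (∑ i ∈ S with i ∈ I, z i)) q
        (by intro S _; simp [Finset.filter_insert, hq]),
        toggle_sum (fun S => P (∑ i ∈ S with i ∉ I, z i)) p
        (by intro S _; simp [Finset.filter_insert, hp])]
      simp
    simp only [hM] at h0
    have h' := h.symm.trans h0
    simpa using h'

noncomputable def clamp (s : ℝ) : ℝ := max 0 (min s 1)
lemma clamp_cont : Continuous clamp := by unfold clamp; fun_prop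
lemma clamp_nonneg (s : ℝ) : 0 ≤ clamp s := le_max_left _ _
lemma clamp_le_one (s : ℝ) : clamp s ≤ 1 := max_le zero_le_one (min_le_right _ _)
lemma clamp_of_le {s : ℝ} (h : s ≤ 0) : clamp s = 0 := by
  unfold clamp; rw [min_eq_left (by linarith), max_eq_left h]
lemma clamp_of_ge {s : ℝ} (h : 1 ≤ s) : clamp s = 1 := by
  unfold clamp; rw [min_eq_right h, max_eq_right zero_le_one]

lemma layer_vanish (N : ContinuousMultilinearMap ℂ (fun _ : Fin k => C(K, ℂ)) ℂ)
    (hN : OrthVanish N) (u : C(K, ℝ)) (p q : Fin k) (F : Finset (Fin k)) (hp : p ∉ F) (hq : q ∉ F) :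
    ∀ (a b : ℝ), a < b → ∀ (z : Fin k → C(K, ℂ)) (I : Set (Fin k)), p ∈ I → q ∉ I →
      (∀ i, i ∉ F → i ∈ I → ∀ t, u t ≤ b → z i t = 0) →
      (∀ i, i ∉ F → i ∉ I → ∀ t, a ≤ u t → z i t = 0) → N z = 0 := by
  classical
  induction F using Finset.induction_on with
  | empty =>
    intro a b hab z I hpI hqI h1 h2
    refine hN z I p q hpI hqI fun i j hi hj => ?_
    ext t
    rcases le_total (u t) b with h | h
    · simp [h1 i (by simp) hi t h]
    · simp [h2 j (by simp) hj t (hab.le.trans h)]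
  | insert c F hc ih =>
    intro a b hab z I hpI hqI h1 h2
    simp only [Finset.mem_insert, not_or] at hp hq h1 h2
    have ih := ih hp.2 hq.2
    set m := (2 * a + b) / 3 with hm
    set m' := (a + 2 * b) / 3 with hm'
    have hmm : 0 < m' - m := by rw [hm, hm']; linarith
    let h : C(K, ℂ) := ⟨fun t => ((clamp ((u t - m) / (m' - m)) : ℝ) : ℂ), by
      have := clamp_cont
      fun_prop⟩
    have hz : z = Function.update z c (h * z c + (1 - h) * z c) := by
      rw [← add_mul]; simp
    rw [hz, N.map_update_add]
    have e1 : N (Function.update z c (h * z c)) = 0 := by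
      refine ih a m (by rw [hm]; linarith) _ (insert c I) (by simp [hpI])
        (by simp [hqI, hq.1]) ?_ ?_
      · intro i hiF hi t ht
        by_cases hic : i = c
        · subst hic
          have : h t = 0 := by
            simp only [h, ContinuousMap.coe_mk]
            rw [clamp_of_le]; · simp
            exact div_nonpos_of_nonpos_of_nonneg (by linarith) hmm.le
          simp [this]
        · rw [Function.update_of_ne hic]
          exact h1 i ⟨hic, hiF⟩ (by simpa [hic] using hi) t (by linarith)
      · intro i hiF hi t ht
        simp only [Set.mem_insert_iff, not_or] at hi
        rw [Function.update_of_ne hi.1]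
        exact h2 i ⟨hi.1, hiF⟩ hi.2 t ht
    have e2 : N (Function.update z c ((1 - h) * z c)) = 0 := by
      refine ih m' b (by rw [hm']; linarith) _ (I \ {c}) ⟨hpI, by simpa using hp.1⟩
        (by simp [hqI]) ?_ ?_
      · intro i hiF hi t ht
        rw [Function.update_of_ne hi.2]
        exact h1 i ⟨hi.2, hiF⟩ hi.1 t ht
      · intro i hiF hi t ht
        by_cases hic : i = c
        · subst hic
          have : h t = 1 := by
            simp only [h, ContinuousMap.coe_mk]
            rw [clamp_of_ge]; · simp
            rw [le_div_iff₀ hmm]; linarith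
          simp [this]
        · rw [Function.update_of_ne hic]
          exact h2 i ⟨hic, hiF⟩ (by simpa [hic] using hi) t (by linarith)
    rw [e1, e2, add_zero]

lemma pair_vanish (N : ContinuousMultilinearMap ℂ (fun _ : Fin k => C(K, ℂ)) ℂ)
    (hN : OrthVanish N) (z : Fin k → C(K, ℂ)) (p q : Fin k) (hpq : p ≠ q) (h : z p * z q = 0) :
    N z = 0 := by
  classical
  let u : C(K, ℝ) := ⟨fun t => ‖z p t‖, by fun_prop⟩
  let x : ℕ → C(K, ℂ) := fun n => ⟨fun t => z p t * ((clamp ((n + 1) * ‖z p t‖ - 1) : ℝ) : ℂ), by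
    have := clamp_cont
    fun_prop⟩
  have hx : Tendsto x atTop (𝓝 (z p)) := by
    rw [tendsto_iff_norm_sub_tendsto_zero]
    have hl : Tendsto (fun n : ℕ => 2 * (1 / ((n : ℝ) + 1))) atTop (𝓝 0) := by
      simpa using tendsto_one_div_add_atTop_nhds_zero_nat.const_mul (2 : ℝ)
    refine squeeze_zero (fun _ => norm_nonneg _) (fun n => ?_) hl
    rw [ContinuousMap.norm_le _ (by positivity)]
    intro t
    have hn : (0 : ℝ) < n + 1 := by positivity
    have e : (x n - z p) t = z p t * ((clamp ((n + 1) * ‖z p t‖ - 1) - 1 : ℝ) : ℂ) := by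
      simp only [x, ContinuousMap.sub_apply, ContinuousMap.coe_mk]; push_cast; ring
    rw [e, norm_mul, Complex.norm_real]
    rcases le_total 1 ((n + 1) * ‖z p t‖ - 1) with h1 | h1
    · rw [clamp_of_ge h1]; simp; positivity
    · have h2 : ‖z p t‖ ≤ 2 * (1 / ((n : ℝ) + 1)) := by
        rw [mul_one_div, le_div_iff₀ hn]; linarith
      have h3 : ‖clamp ((n + 1) * ‖z p t‖ - 1) - 1‖ ≤ 1 := by
        rw [Real.norm_eq_abs, abs_le]
        constructor <;> linarith [clamp_nonneg ((n + 1) * ‖z p t‖ - 1), clamp_le_one ((n + 1) * ‖z p t‖ - 1)]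
      calc _ ≤ ‖z p t‖ * 1 := by gcongr
        _ ≤ _ := by linarith
  have hx' : Tendsto (fun n => Function.update z p (x n)) atTop (𝓝 z) := by
    have := (tendsto_const_nhds (x := z) (f := atTop (α := ℕ))).update p hx
    simpa using this
  have hlim := (N.cont.tendsto z).comp hx'
  refine tendsto_nhds_unique hlim (tendsto_const_nhds.congr fun n => ?_)
  symm
  have hn : (0 : ℝ) < n + 1 := by positivity
  refine layer_vanish N hN u p q (Finset.univ \ {p, q}) (by simp) (by simp)
    (1 / (2 * (n + 1))) (1 / (n + 1)) ?_ _ {p} rfl (fun h => hpq h.symm) ?_ ?_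
  · rw [one_div_lt_one_div (by positivity) hn]; linarith
  · rintro i - rfl t ht
    have : u t = ‖z i t‖ := rfl
    rw [this, le_div_iff₀ hn] at ht
    simp only [Function.update_self, x, ContinuousMap.coe_mk]
    rw [clamp_of_le (by linarith)]; simp
  · intro i hi hip t ht
    have hiq : i = q := by
      by_contra hne
      exact hi (by simp; exact ⟨hip, hne⟩)
    subst hiq
    change (Function.update z p (x n) i) t = 0
    rw [Function.update_of_ne hip]
    have h0 : z p t ≠ 0 := by
      have : u t = ‖z p t‖ := rfl
      intro h0
      rw [this, h0, norm_zero] at ht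
      have : 0 < 1 / (2 * ((n : ℝ) + 1)) := by positivity
      linarith
    have := DFunLike.congr_fun h t
    simpa [h0] using this


lemma norm_sum_disjoint (s : Finset ℕ) (a : ℕ → C(K, ℂ)) (α : ℝ) (hα : 0 ≤ α)
    (hd : ∀ i ∈ s, ∀ j ∈ s, i ≠ j → ∀ t, a i t = 0 ∨ a j t = 0) (hb : ∀ i t, ‖a i t‖ ≤ α) :
    ‖∑ i ∈ s, a i‖ ≤ α := by
  rw [ContinuousMap.norm_le _ hα]
  intro t
  rw [ContinuousMap.sum_apply]
  by_cases h : ∃ i ∈ s, a i t ≠ 0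
  · obtain ⟨i, hi, hit⟩ := h
    rw [Finset.sum_eq_single_of_mem i hi]
    · exact hb i t
    · intro j hj hji
      exact (hd i hi j hj hji.symm t).resolve_left hit
  · push Not at h
    rw [Finset.sum_eq_zero h]; simpa using hα

lemma block_bound (B : C(K, ℂ) →ₗ[ℂ] C(K, ℂ) →ₗ[ℂ] ℂ) (C : ℝ) (hC0 : 0 ≤ C)
    (hC : ∀ x y, ‖B x y‖ ≤ C * ‖x‖ * ‖y‖) (h0 : ∀ x y, x * y = 0 → B x y = 0)
    (s : K → ℝ) (a b : ℕ → C(K, ℂ)) (α β : ℝ) (hα : 0 ≤ α) (hβ : 0 ≤ β)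
    (ha : ∀ i t, ‖a i t‖ ≤ α) (hb : ∀ i t, ‖b i t‖ ≤ β)
    (ha' : ∀ (i : ℕ) (t : K), 2 ≤ |s t - i| → a i t = 0) (hb' : ∀ (i : ℕ) (t : K), 2 ≤ |s t - i| → b i t = 0) (m : ℕ) :
    ‖∑ i ∈ Finset.range m, B (a i) (b i)‖ ≤ 4 * (C * α * β) := by
  have hmap : ∀ i ∈ Finset.range m, i % 4 ∈ Finset.range 4 := fun i _ =>
    Finset.mem_range.2 (Nat.mod_lt _ (by norm_num))
  rw [← Finset.sum_fiberwise_of_maps_to hmap]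
  have key : ∀ r ∈ Finset.range 4, ‖∑ i ∈ Finset.range m with i % 4 = r, B (a i) (b i)‖ ≤ C * α * β := by
    intro r _
    set S := (Finset.range m).filter (fun i => i % 4 = r) with hS
    have far : ∀ i ∈ S, ∀ j ∈ S, i ≠ j → ∀ t, 2 ≤ |s t - i| ∨ 2 ≤ |s t - j| := by
      intro i hi j hj hij t
      have hi' := (Finset.mem_filter.1 hi).2
      have hj' := (Finset.mem_filter.1 hj).2
      by_contra! hcon
      have h1 := abs_lt.1 hcon.1
      have h2 := abs_lt.1 hcon.2
      have h3 : (i : ℝ) < j + 4 := by linarith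
      have h4 : (j : ℝ) < i + 4 := by linarith
      norm_cast at h3 h4
      omega
    have e : ∑ i ∈ S, B (a i) (b i) = B (∑ i ∈ S, a i) (∑ i ∈ S, b i) := by
      rw [map_sum B, LinearMap.sum_apply]
      refine Finset.sum_congr rfl fun i hi => ?_
      rw [map_sum, Finset.sum_eq_single_of_mem i hi]
      intro j hj hji
      apply h0
      ext t
      rcases far i hi j hj hji.symm t with h | h
      · simp [ha' i t h]
      · simp [hb' j t h]
    rw [e]
    refine (hC _ _).trans ?_
    have n1 : ‖∑ i ∈ S, a i‖ ≤ α := norm_sum_disjoint S a α hα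
      (fun i hi j hj hij t => (far i hi j hj hij t).imp (ha' i t) (ha' j t)) ha
    have n2 : ‖∑ i ∈ S, b i‖ ≤ β := norm_sum_disjoint S b β hβ
      (fun i hi j hj hij t => (far i hi j hj hij t).imp (hb' i t) (hb' j t)) hb
    gcongr
  refine (norm_sum_le_of_le _ key).trans ?_
  simp

lemma zero_prod_bound (B : C(K, ℂ) →ₗ[ℂ] C(K, ℂ) →ₗ[ℂ] ℂ) (C : ℝ) (hC0 : 0 ≤ C)
    (hC : ∀ x y, ‖B x y‖ ≤ C * ‖x‖ * ‖y‖) (h0 : ∀ x y, x * y = 0 → B x y = 0)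
    (x y : C(K, ℂ)) (v : C(K, ℝ)) (hv0 : ∀ t, 0 ≤ v t) (hv1 : ∀ t, v t ≤ 1)
    (hy : ∀ t, y t = (v t : ℂ)) (n : ℕ) :
    ‖B x y - B (x * y) 1‖ ≤ 16 * C * ‖x‖ * (1 / ((n : ℝ) + 1)) := by
  have hn : (0 : ℝ) < n + 1 := by positivity
  have hcl := clamp_cont
  let s : K → ℝ := fun t => (n + 1) * v t
  let F : ℕ → C(K, ℂ) := fun i =>
    ⟨fun t => ((clamp ((n + 1) * v t - i + 1) - clamp ((n + 1) * v t - i) : ℝ) : ℂ), by fun_prop⟩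
  let G : ℕ → C(K, ℂ) := fun i => ⟨fun t => ((clamp (2 - |(n + 1) * v t - i|) : ℝ) : ℂ), by fun_prop⟩
  let c : ℕ → ℂ := fun i => (((i : ℝ) / (n + 1) : ℝ) : ℂ)
  let D : ℕ → C(K, ℂ) := fun i => y - ContinuousMap.const K (c i)
  have hF0 : ∀ (i : ℕ) (t : K), 1 ≤ |s t - i| → F i t = 0 := by
    intro i t h
    simp only [F, ContinuousMap.coe_mk]
    rcases le_abs.1 h with h | h
    · rw [clamp_of_ge, clamp_of_ge] <;> [simp; exact h; (simp only [s] at h; linarith)]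
    · rw [clamp_of_le, clamp_of_le] <;> [simp; (simp only [s] at h; linarith); (simp only [s] at h; linarith)]
  have hG0 : ∀ (i : ℕ) (t : K), 2 ≤ |s t - i| → G i t = 0 := by
    intro i t h
    simp only [G, ContinuousMap.coe_mk]
    rw [clamp_of_le] <;> [simp; (simp only [s] at h; linarith)]
  have hG1 : ∀ (i : ℕ) (t : K), |s t - i| ≤ 1 → G i t = 1 := by
    intro i t h
    simp only [G, ContinuousMap.coe_mk]
    rw [clamp_of_ge] <;> [simp; (simp only [s] at h; linarith)]
  have hFn : ∀ i t, ‖F i t‖ ≤ 1 := by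
    intro i t
    simp only [F, ContinuousMap.coe_mk]
    rw [Complex.norm_real, Real.norm_eq_abs, abs_le]
    constructor <;> linarith [clamp_nonneg ((n + 1) * v t - i + 1), clamp_le_one ((n + 1) * v t - i + 1),
      clamp_nonneg ((n + 1) * v t - i), clamp_le_one ((n + 1) * v t - i)]
  have hGn : ∀ i t, ‖G i t‖ ≤ 1 := by
    intro i t
    simp only [G, ContinuousMap.coe_mk]
    rw [Complex.norm_real, Real.norm_eq_abs, abs_le]
    constructor <;> linarith [clamp_nonneg (2 - |(n + 1) * v t - i|), clamp_le_one (2 - |(n + 1) * v t - i|)]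
  have hDn : ∀ (i : ℕ) (t : K), |s t - i| ≤ 2 → ‖D i t‖ ≤ 2 * (1 / ((n : ℝ) + 1)) := by
    intro i t h
    have : D i t = (((s t - i) / (n + 1) : ℝ) : ℂ) := by
      have : v t - (i : ℝ) / (n + 1) = (s t - i) / (n + 1) := by
        simp only [s]; field_simp
      rw [← this]
      simp [D, c, hy]
    rw [this, Complex.norm_real, Real.norm_eq_abs, abs_div, abs_of_pos hn, mul_one_div]
    gcongr
  have hsum : ∑ i ∈ Finset.range (n + 2), F i = 1 := by
    ext t
    rw [ContinuousMap.sum_apply]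
    have h1 := Finset.sum_range_sub' (fun i : ℕ => clamp ((n + 1) * v t - i + 1)) (n + 2)
    have h2 : ∀ i : ℕ, (n + 1) * v t - ((i + 1 : ℕ) : ℝ) + 1 = (n + 1) * v t - i := by
      intro i; push_cast; ring
    simp only [h2] at h1
    have a1 : clamp ((n + 1) * v t - ((0 : ℕ) : ℝ) + 1) = 1 := by
      apply clamp_of_ge
      have := mul_nonneg hn.le (hv0 t)
      push_cast; linarith
    have a2 : clamp ((n + 1) * v t - ((n + 1 : ℕ) : ℝ)) = 0 := by
      apply clamp_of_le
      have := mul_le_mul_of_nonneg_left (hv1 t) hn.le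
      push_cast; linarith
    rw [a1, a2] at h1
    simp only [F, ContinuousMap.coe_mk, ← Complex.ofReal_sum, h1]
    simp
  have hFG : ∀ i, F i * (1 - G i) = 0 := by
    intro i
    ext t
    rcases le_total (|s t - i|) 1 with h | h
    · simp [hG1 i t h]
    · simp [hF0 i t h]
  have hloc : ∀ i (a b : C(K, ℂ)), B (F i * a) b = B (F i * a) (b * G i) := by
    intro i a b
    rw [← sub_eq_zero, ← map_sub]
    apply h0
    calc F i * a * (b - b * G i) = F i * (1 - G i) * (a * b) := by ring
      _ = 0 := by rw [hFG, zero_mul]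
  have hconst : ∀ i, ContinuousMap.const K (c i) = c i • (1 : C(K, ℂ)) := by
    intro i; ext t; simp
  have hterm : ∀ i, B (F i * x) y - B (F i * (x * y)) 1 =
      B (F i * x) (D i * G i) - B (F i * x * D i) (G i) := by
    intro i
    rw [hloc i x y, hloc i (x * y) 1, one_mul]
    have d1 : D i * G i = y * G i - c i • G i := by
      simp only [D, hconst, sub_mul, smul_mul_assoc, one_mul]
    have d2 : F i * x * D i = F i * (x * y) - c i • (F i * x) := by
      simp only [D, hconst, mul_sub, mul_smul_comm, mul_one, mul_assoc]
    rw [d1, d2, map_sub, map_sub, LinearMap.sub_apply, map_smul, map_smul, LinearMap.smul_apply]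
    ring
  have htot : B x y - B (x * y) 1 = ∑ i ∈ Finset.range (n + 2), B (F i * x) (D i * G i) -
      ∑ i ∈ Finset.range (n + 2), B (F i * x * D i) (G i) := by
    rw [← Finset.sum_sub_distrib, ← Finset.sum_congr rfl (fun i _ => hterm i), Finset.sum_sub_distrib,
      ← LinearMap.sum_apply, ← LinearMap.sum_apply, ← map_sum, ← map_sum, ← Finset.sum_mul,
      ← Finset.sum_mul, hsum, one_mul, one_mul]
  have hFx : ∀ i t, ‖(F i * x) t‖ ≤ ‖x‖ := by
    intro i t
    rw [ContinuousMap.mul_apply, norm_mul]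
    calc _ ≤ 1 * ‖x‖ := mul_le_mul (hFn i t) (x.norm_coe_le_norm t) (norm_nonneg _) zero_le_one
      _ = _ := one_mul _
  have hF2 : ∀ (i : ℕ) (t : K), 2 ≤ |s t - i| → F i t = 0 := fun i t h => hF0 i t (by linarith)
  have b1 := block_bound B C hC0 hC h0 s (fun i => F i * x) (fun i => D i * G i) ‖x‖
    (2 * (1 / ((n : ℝ) + 1))) (norm_nonneg _) (by positivity) hFx
    (by
      intro i t
      rcases le_total (|s t - i|) 2 with h | h
      · rw [ContinuousMap.mul_apply, norm_mul]
        calc _ ≤ (2 * (1 / ((n : ℝ) + 1))) * 1 := mul_le_mul (hDn i t h) (hGn i t) (norm_nonneg _) (by positivity)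
          _ = _ := mul_one _
      · rw [ContinuousMap.mul_apply, hG0 i t h, mul_zero, norm_zero]; positivity)
    (by intro i t h; simp [hF2 i t h]) (by intro i t h; simp [hG0 i t h]) (n + 2)
  have b2 := block_bound B C hC0 hC h0 s (fun i => F i * x * D i) G (‖x‖ * (2 * (1 / ((n : ℝ) + 1))))
    1 (by positivity) zero_le_one
    (by
      intro i t
      rcases le_total (|s t - i|) 2 with h | h
      · rw [ContinuousMap.mul_apply, norm_mul]
        exact mul_le_mul (hFx i t) (hDn i t h) (norm_nonneg _) (by positivity)
      · rw [ContinuousMap.mul_apply, ContinuousMap.mul_apply, hF2 i t h, zero_mul, zero_mul, norm_zero]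
        positivity)
    hGn (by intro i t h; simp [hF2 i t h]) hG0 (n + 2)
  rw [htot]
  refine (norm_sub_le _ _).trans ?_
  calc _ ≤ _ := add_le_add b1 b2
    _ = _ := by ring

lemma zero_prod (B : C(K, ℂ) →ₗ[ℂ] C(K, ℂ) →ₗ[ℂ] ℂ) (C : ℝ) (hC0 : 0 ≤ C)
    (hC : ∀ x y, ‖B x y‖ ≤ C * ‖x‖ * ‖y‖) (h0 : ∀ x y, x * y = 0 → B x y = 0)
    (x y : C(K, ℂ)) : B x y = B (x * y) 1 := by
  have s1 : ∀ (y : C(K, ℂ)) (v : C(K, ℝ)), (∀ t, 0 ≤ v t) → (∀ t, v t ≤ 1) →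
      (∀ t, y t = (v t : ℂ)) → B x y = B (x * y) 1 := by
    intro y v hv0 hv1 hy
    have hl : Tendsto (fun n : ℕ => 16 * C * ‖x‖ * (1 / ((n : ℝ) + 1))) atTop (𝓝 0) := by
      simpa using tendsto_one_div_add_atTop_nhds_zero_nat.const_mul (16 * C * ‖x‖)
    have := ge_of_tendsto' hl (zero_prod_bound B C hC0 hC h0 x y v hv0 hv1 hy)
    rw [norm_le_zero_iff, sub_eq_zero] at this
    exact this
  -- the set of good `y` is a subspace
  let W : Submodule ℂ C(K, ℂ) :=
    { carrier := {y | B x y = B (x * y) 1}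
      add_mem' := by
        intro a b ha hb
        simp only [Set.mem_ofPred_eq] at *
        rw [mul_add, map_add, map_add, LinearMap.add_apply, ha, hb]
      zero_mem' := by simp
      smul_mem' := by
        intro c a ha
        simp only [Set.mem_ofPred_eq] at *
        rw [mul_smul_comm, map_smul, map_smul, LinearMap.smul_apply, ha] }
  have s2 : ∀ (v : C(K, ℝ)), (⟨fun t => (v t : ℂ), by fun_prop⟩ : C(K, ℂ)) ∈ W := by
    intro v
    set R : ℝ := ‖v‖ + 1 with hR
    have hRpos : 0 < R := by positivity
    let e : C(K, ℝ) := ⟨fun t => (v t + R) / (2 * R), by fun_prop⟩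
    have hvt : ∀ t, |v t| ≤ ‖v‖ := fun t => v.norm_coe_le_norm t
    have he : (⟨fun t => (e t : ℂ), by fun_prop⟩ : C(K, ℂ)) ∈ W := by
      refine s1 _ e (fun t => ?_) (fun t => ?_) (fun t => rfl)
      · have := abs_le.1 (hvt t)
        exact div_nonneg (by linarith) (by positivity)
      · have := abs_le.1 (hvt t)
        simp only [e, ContinuousMap.coe_mk]
        rw [div_le_one (by positivity)]; linarith
    have h1 : (1 : C(K, ℂ)) ∈ W := by
      refine s1 _ 1 (fun t => ?_) (fun t => ?_) (fun t => ?_) <;> simp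
    have : (⟨fun t => (v t : ℂ), by fun_prop⟩ : C(K, ℂ)) =
        ((2 * R : ℝ) : ℂ) • (⟨fun t => (e t : ℂ), by fun_prop⟩ : C(K, ℂ)) - (R : ℂ) • 1 := by
      ext t
      have : (R : ℂ) ≠ 0 := by exact_mod_cast hRpos.ne'
      simp [e]
      field_simp
      ring
    rw [this]
    exact W.sub_mem (W.smul_mem _ he) (W.smul_mem _ h1)
  have hyW : y ∈ W := by
    have hre := s2 ⟨fun t => (y t).re, by fun_prop⟩
    have him := s2 ⟨fun t => (y t).im, by fun_prop⟩
    have := W.add_mem hre (W.smul_mem Complex.I him)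
    convert this using 1
    ext t
    simp [mul_comm Complex.I]
  exact hyW

lemma multi_factor (N : ContinuousMultilinearMap ℂ (fun _ : Fin k => C(K, ℂ)) ℂ)
    (hN : OrthVanish N) (z : Fin k → C(K, ℂ)) (p q : Fin k) (hpq : p ≠ q) (x y : C(K, ℂ)) :
    N (Function.update (Function.update z p x) q y) =
      N (Function.update (Function.update z p (x * y)) q 1) := by
  classical
  let B : C(K, ℂ) →ₗ[ℂ] C(K, ℂ) →ₗ[ℂ] ℂ := LinearMap.mk₂ ℂ
    (fun x y => N (Function.update (Function.update z p x) q y))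
    (by
      intro a b y
      simp only [Function.update_comm hpq]
      exact N.map_update_add _ _ _ _)
    (by
      intro c a y
      simp only [Function.update_comm hpq]
      exact N.map_update_smul _ _ _ _)
    (by intro x a b; exact N.map_update_add _ _ _ _)
    (by intro c x a; exact N.map_update_smul _ _ _ _)
  have hB : ∀ x y, B x y = N (Function.update (Function.update z p x) q y) := fun x y => rfl
  rw [← hB, ← hB]
  refine zero_prod B (‖N‖ * ∏ i ∈ (Finset.univ.erase q).erase p, ‖z i‖) (by positivity) ?_ ?_ x y
  · intro x y
    rw [hB]
    refine (N.le_opNorm _).trans (le_of_eq ?_)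
    rw [← Finset.mul_prod_erase _ _ (Finset.mem_univ q),
      ← Finset.mul_prod_erase (Finset.univ.erase q) _ (Finset.mem_erase.2 ⟨hpq, Finset.mem_univ p⟩)]
    rw [Function.update_self, Function.update_of_ne hpq, Function.update_self]
    have : ∏ i ∈ (Finset.univ.erase q).erase p, ‖Function.update (Function.update z p x) q y i‖ =
        ∏ i ∈ (Finset.univ.erase q).erase p, ‖z i‖ := by
      refine Finset.prod_congr rfl fun i hi => ?_
      simp only [Finset.mem_erase] at hi
      rw [Function.update_of_ne hi.2.1, Function.update_of_ne hi.1]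
    rw [this]
    ring
  · intro x y hxy
    rw [hB]
    refine pair_vanish N hN _ p q hpq ?_
    rw [Function.update_self, Function.update_of_ne hpq, Function.update_self, hxy]

lemma diag_factor (N : ContinuousMultilinearMap ℂ (fun _ : Fin k => C(K, ℂ)) ℂ)
    (hN : OrthVanish N) (p : Fin k) (x : C(K, ℂ)) (T : Finset (Fin k)) (hT : p ∉ T) :
    N (fun _ => x) = N (fun i => if i = p then x ^ (T.card + 1) else if i ∈ T then 1 else x) := by
  classical
  induction T using Finset.induction_on with
  | empty => 
    congr 1
    ext i : 1
    by_cases h : i = p <;> simp [h]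
  | insert q T hq ih =>
    simp only [Finset.mem_insert, not_or] at hT
    rw [ih hT.2]
    have := multi_factor N hN (fun i => if i ∈ T then 1 else x) p q hT.1 (x ^ (T.card + 1)) x
    convert this using 2
    · ext i : 1
      by_cases h1 : i = q
      · subst h1
        simp [hq, Ne.symm hT.1]
      · by_cases h2 : i = p
        · subst h2; simp [h1]
        · simp [h1, h2]
    · ext i : 1
      by_cases h1 : i = q
      · subst h1
        simp [Ne.symm hT.1]
      · by_cases h2 : i = p
        · subst h2; simp [h1, Finset.card_insert_of_notMem hq, pow_succ]
        · simp [h1, h2]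

lemma exists_functional (hk : 1 ≤ k) {P : C(K, ℂ) → ℂ} (hP : IsHomogPoly k P) (hOA : IsOrthAdd P) :
    ∃ φ : C(K, ℂ) →L[ℂ] ℂ, ∀ x, P x = φ (x ^ k) := by
  classical
  obtain ⟨N, hNP, hN⟩ := exists_symm hP hOA
  let p : Fin k := ⟨0, hk⟩
  refine ⟨(k.factorial : ℂ)⁻¹ • N.toContinuousLinearMap (fun _ => 1) p, fun x => ?_⟩
  have h := diag_factor N hN p x (Finset.univ.erase p) (by simp)
  have hf : (k.factorial : ℂ) ≠ 0 := by exact_mod_cast k.factorial_ne_zero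
  have e : (fun i => if i = p then x ^ ((Finset.univ.erase p).card + 1) else
      if i ∈ Finset.univ.erase p then 1 else x) = Function.update (fun _ => (1 : C(K, ℂ))) p (x ^ k) := by
    ext i : 1
    by_cases h1 : i = p
    · subst h1
      simp [Finset.card_erase_of_mem, Nat.sub_add_cancel hk]
    · simp [h1]
  rw [e, hNP] at h
  have : P x = (k.factorial : ℂ)⁻¹ * N (Function.update (fun _ => (1 : C(K, ℂ))) p (x ^ k)) := by
    rw [← h]; field_simp
  rw [this]
  rfl

end AlgPart
open scoped NNReal ENNReal

set_option linter.unusedSectionVars false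
section RieszPart
variable {K : Type*} [TopologicalSpace K] [CompactSpace K]

def varSet (φ : C(K, ℂ) →L[ℂ] ℂ) (f : K → ℝ≥0) : Set ℝ :=
  {r | ∃ g : C(K, ℂ), (∀ t, ‖g t‖ ≤ f t) ∧ r = ‖φ g‖}

noncomputable def varFun (φ : C(K, ℂ) →L[ℂ] ℂ) (f : K → ℝ≥0) : ℝ := sSup (varSet φ f)

lemma varSet_zero_mem (φ : C(K, ℂ) →L[ℂ] ℂ) (f : K → ℝ≥0) : 0 ∈ varSet φ f :=
  ⟨0, fun t => by simp, by simp⟩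

lemma varSet_bdd (φ : C(K, ℂ) →L[ℂ] ℂ) (f : K → ℝ≥0) (hf : Continuous f) :
    BddAbove (varSet φ f) := by
  have hc : Continuous (fun t => (f t : ℝ)) := by fun_prop
  refine ⟨‖φ‖ * ‖(⟨fun t => (f t : ℝ), hc⟩ : C(K, ℝ))‖, ?_⟩
  rintro r ⟨g, hg, rfl⟩
  refine (φ.le_opNorm g).trans ?_
  gcongr
  rw [ContinuousMap.norm_le _ (norm_nonneg _)]
  intro t
  refine (hg t).trans ?_
  have := ContinuousMap.norm_coe_le_norm (⟨fun t => (f t : ℝ), hc⟩ : C(K, ℝ)) t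
  simpa using this

lemma le_varFun (φ : C(K, ℂ) →L[ℂ] ℂ) (f : K → ℝ≥0) (hf : Continuous f) (g : C(K, ℂ))
    (hg : ∀ t, ‖g t‖ ≤ f t) : ‖φ g‖ ≤ varFun φ f :=
  le_csSup (varSet_bdd φ f hf) ⟨g, hg, rfl⟩

lemma varFun_nonneg (φ : C(K, ℂ) →L[ℂ] ℂ) (f : K → ℝ≥0) (hf : Continuous f) :
    0 ≤ varFun φ f := le_csSup (varSet_bdd φ f hf) (varSet_zero_mem φ f)

lemma varFun_le (φ : C(K, ℂ) →L[ℂ] ℂ) (f : K → ℝ≥0) (c : ℝ)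
    (h : ∀ g : C(K, ℂ), (∀ t, ‖g t‖ ≤ f t) → ‖φ g‖ ≤ c) : varFun φ f ≤ c := by
  refine csSup_le ⟨0, varSet_zero_mem φ f⟩ ?_
  rintro r ⟨g, hg, rfl⟩
  exact h g hg

lemma exists_phase (z : ℂ) : ∃ c : ℂ, ‖c‖ = 1 ∧ c * z = ‖z‖ := by
  by_cases h : z = 0
  · exact ⟨1, by simp, by simp [h]⟩
  · have h' : (‖z‖ : ℂ) ≠ 0 := by simpa using h
    refine ⟨starRingEnd ℂ z / ‖z‖, ?_, ?_⟩
    · simp [h]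
    · field_simp
      rw [mul_comm, Complex.mul_conj, Complex.normSq_eq_norm_sq]; push_cast; ring

lemma varFun_add (φ : C(K, ℂ) →L[ℂ] ℂ) (f₁ f₂ : K → ℝ≥0) (h₁ : Continuous f₁)
    (h₂ : Continuous f₂) : varFun φ (f₁ + f₂) = varFun φ f₁ + varFun φ f₂ := by
  apply le_antisymm
  · refine varFun_le _ _ _ fun g hg => ?_
    refine le_of_forall_pos_le_add fun ε hε => ?_
    obtain ⟨δ, hδ, hδε⟩ : ∃ δ > 0, ‖φ‖ * δ ≤ ε := by
      refine ⟨ε / (‖φ‖ + 1), by positivity, ?_⟩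
      rw [mul_div_assoc', div_le_iff₀ (by positivity)]
      nlinarith [norm_nonneg φ]
    have hpos : ∀ t, 0 < (f₁ t : ℝ) + f₂ t + δ := fun t => by positivity
    have hne : ∀ t, ((f₁ t : ℝ) : ℂ) + ((f₂ t : ℝ) : ℂ) + (δ : ℂ) ≠ 0 := fun t => by
      have := (hpos t).ne'
      exact_mod_cast this
    let g₁ : C(K, ℂ) := ⟨fun t => g t * (f₁ t : ℝ) / ((f₁ t : ℝ) + (f₂ t : ℝ) + δ),
      by refine Continuous.div (by fun_prop) (by fun_prop) hne⟩
    let g₂ : C(K, ℂ) := ⟨fun t => g t * (f₂ t : ℝ) / ((f₁ t : ℝ) + (f₂ t : ℝ) + δ),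
      by refine Continuous.div (by fun_prop) (by fun_prop) hne⟩
    have hn : ∀ t, ‖((f₁ t : ℝ) : ℂ) + ((f₂ t : ℝ) : ℂ) + (δ : ℂ)‖ = (f₁ t : ℝ) + f₂ t + δ := by
      intro t
      rw [← Complex.ofReal_add, ← Complex.ofReal_add, Complex.norm_real, Real.norm_of_nonneg (hpos t).le]
    have hgt : ∀ t, ‖g t‖ ≤ (f₁ t : ℝ) + f₂ t := fun t => by simpa using hg t
    have b₁ : ‖φ g₁‖ ≤ varFun φ f₁ := by
      refine le_varFun φ f₁ h₁ _ fun t => ?_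
      simp only [g₁, ContinuousMap.coe_mk, norm_div, norm_mul, hn, Complex.norm_real]
      rw [Real.norm_of_nonneg (by positivity), div_le_iff₀ (hpos t), mul_comm]
      gcongr
      linarith [hgt t]
    have b₂ : ‖φ g₂‖ ≤ varFun φ f₂ := by
      refine le_varFun φ f₂ h₂ _ fun t => ?_
      simp only [g₂, ContinuousMap.coe_mk, norm_div, norm_mul, hn, Complex.norm_real]
      rw [Real.norm_of_nonneg (by positivity), div_le_iff₀ (hpos t), mul_comm]
      gcongr
      linarith [hgt t]
    have b₃ : ‖φ (g - g₁ - g₂)‖ ≤ ε := by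
      refine (φ.le_opNorm _).trans (le_trans ?_ hδε)
      gcongr
      rw [ContinuousMap.norm_le _ hδ.le]
      intro t
      have : (g - g₁ - g₂) t = g t * δ / ((f₁ t : ℝ) + (f₂ t : ℝ) + δ) := by
        have := hne t
        simp only [g₁, g₂, ContinuousMap.sub_apply, ContinuousMap.coe_mk]
        field_simp
        ring
      rw [this, norm_div, norm_mul, hn, Complex.norm_real, Real.norm_of_nonneg hδ.le,
        div_le_iff₀ (hpos t), mul_comm]
      gcongr
      linarith [hgt t]
    have : φ g = φ g₁ + φ g₂ + φ (g - g₁ - g₂) := by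
      rw [← map_add, ← map_add]; congr 1; abel
    rw [this]
    exact (norm_add₃_le).trans (by linarith)
  · have key : ∀ u v : C(K, ℂ), (∀ t, ‖u t‖ ≤ f₁ t) → (∀ t, ‖v t‖ ≤ f₂ t) →
        ‖φ u‖ + ‖φ v‖ ≤ varFun φ (f₁ + f₂) := by
      intro u v hu hv
      obtain ⟨c, hc, hcu⟩ := exists_phase (φ u)
      obtain ⟨d, hd, hdv⟩ := exists_phase (φ v)
      have := le_varFun φ (f₁ + f₂) (h₁.add h₂) (c • u + d • v) (fun t => by
        simp only [ContinuousMap.add_apply, ContinuousMap.smul_apply, Pi.add_apply, NNReal.coe_add]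
        refine (norm_add_le _ _).trans ?_
        rw [norm_smul, norm_smul, hc, hd, one_mul, one_mul]
        exact add_le_add (hu t) (hv t))
      rw [map_add, map_smul, map_smul, smul_eq_mul, smul_eq_mul, hcu, hdv, ← Complex.ofReal_add,
        Complex.norm_real, Real.norm_of_nonneg (by positivity)] at this
      exact this
    have s1 : varFun φ f₁ ≤ varFun φ (f₁ + f₂) - varFun φ f₂ := by
      refine varFun_le _ _ _ fun u hu => ?_
      have : varFun φ f₂ ≤ varFun φ (f₁ + f₂) - ‖φ u‖ := varFun_le _ _ _ fun v hv => by
        linarith [key u v hu hv]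
      linarith
    linarith

lemma varFun_smul_ge (φ : C(K, ℂ) →L[ℂ] ℂ) (c : ℝ≥0) (f : K → ℝ≥0) (h : Continuous f) :
    c * varFun φ f ≤ varFun φ (c • f) := by
  rcases eq_or_ne c 0 with rfl | hc
  · simpa using varFun_nonneg φ _ (h.const_smul (0 : ℝ≥0))
  have hc' : (0 : ℝ) < c := by positivity
  rw [← le_div_iff₀' hc']
  refine varFun_le _ _ _ fun g hg => ?_
  rw [le_div_iff₀' hc']
  have := le_varFun φ (c • f) (h.const_smul c) (((c : ℝ) : ℂ) • g) (fun t => by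
    simp only [ContinuousMap.smul_apply, Pi.smul_apply, smul_eq_mul, NNReal.coe_mul]
    rw [norm_mul, Complex.norm_real, Real.norm_of_nonneg hc'.le]
    gcongr
    exact hg t)
  rw [map_smul, norm_smul, Complex.norm_real, Real.norm_of_nonneg hc'.le] at this
  exact this

lemma varFun_smul (φ : C(K, ℂ) →L[ℂ] ℂ) (c : ℝ≥0) (f : K → ℝ≥0) (h : Continuous f) :
    varFun φ (c • f) = c * varFun φ f := by
  refine le_antisymm ?_ (varFun_smul_ge φ c f h)
  rcases eq_or_ne c 0 with rfl | hc
  · simp only [zero_smul, NNReal.coe_zero, zero_mul]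
    have := varFun_add φ 0 0 continuous_zero continuous_zero
    rw [add_zero] at this
    linarith
  · have := varFun_smul_ge φ c⁻¹ (c • f) (h.const_smul c)
    rw [smul_smul, inv_mul_cancel₀ hc, one_smul] at this
    have hc' : (0 : ℝ) < c := by positivity
    rw [NNReal.coe_inv, inv_mul_le_iff₀ hc'] at this
    exact this

variable [T2Space K] [MeasurableSpace K] [BorelSpace K]

lemma exists_dominating (φ : C(K, ℂ) →L[ℂ] ℂ) :
    ∃ μ : Measure K, IsFiniteMeasure μ ∧ μ.Regular ∧
      ∀ g : C(K, ℂ), ‖φ g‖ ≤ ∫ t, ‖g t‖ ∂μ := by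
  let Λ : CompactlySupportedContinuousMap K ℝ≥0 →ₗ[ℝ≥0] ℝ≥0 :=
    { toFun := fun f => ⟨varFun φ f, varFun_nonneg φ f f.continuous⟩
      map_add' := fun f g => by
        apply NNReal.eq
        exact varFun_add φ f g f.continuous g.continuous
      map_smul' := fun c f => by
        apply NNReal.eq
        exact varFun_smul φ c f f.continuous }
  have hreg : (NNRealRMK.rieszMeasure Λ).Regular := inferInstance
  refine ⟨NNRealRMK.rieszMeasure Λ, ⟨isCompact_univ.measure_lt_top⟩, inferInstance, fun g => ?_⟩
  let f : CompactlySupportedContinuousMap K ℝ≥0 :=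
    ⟨⟨fun t => ‖g t‖₊, by fun_prop⟩, HasCompactSupport.of_compactSpace _⟩
  have h1 := NNRealRMK.integral_rieszMeasure Λ f
  have h2 : ‖φ g‖ ≤ varFun φ f := le_varFun φ f f.continuous g (fun t => le_rfl)
  have h3 : ((Λ f : ℝ≥0) : ℝ) = varFun φ f := rfl
  rw [← h3, ← h1] at h2
  exact h2

lemma regular_withDensity (μ : Measure K) [IsFiniteMeasure μ] [μ.Regular] (f : K → ℝ≥0∞)
    (hfi : ∫⁻ t, f t ∂μ ≠ ∞) : (μ.withDensity f).Regular := by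
  have : IsFiniteMeasure (μ.withDensity f) := isFiniteMeasure_withDensity hfi
  have : (μ.withDensity f).InnerRegularCompactLTTop := by
    refine ⟨fun A ⟨hA, _⟩ r hr => ?_⟩
    obtain ⟨δ, hδ, h⟩ := exists_pos_setLIntegral_lt_of_measure_lt hfi
      (ε := μ.withDensity f A - r) (tsub_pos_of_lt hr).ne'
    obtain ⟨C, hCA, hC, hlt⟩ := hA.exists_isCompact_sdiff_lt (measure_ne_top μ A) hδ.ne'
    refine ⟨C, hCA, hC, ?_⟩
    have h' := h _ hlt
    rw [← withDensity_apply _ (hA.diff hC.measurableSet)] at h'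
    have h2 : μ.withDensity f A ≤ μ.withDensity f (A \ C) + μ.withDensity f C := by
      refine (measure_mono ?_).trans (measure_union_le _ _)
      intro x hx; by_cases hxc : x ∈ C <;> simp [hx, hxc]
    by_contra! hle
    exact absurd h' (not_lt.2 ((tsub_le_tsub_left hle _).trans (tsub_le_iff_right.2 h2)))
  infer_instance

lemma exists_density (φ : C(K, ℂ) →L[ℂ] ℂ) :
    ∃ (μ : Measure K) (v : K → ℂ), IsFiniteMeasure μ ∧ μ.Regular ∧ Measurable v ∧ Integrable v μ ∧
      ∀ g : C(K, ℂ), φ g = ∫ t, g t * v t ∂μ := by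
  obtain ⟨μ, hfin, hreg, hμ⟩ := exists_dominating φ
  have hd : DenseRange (ContinuousMap.toLp 2 μ ℂ : C(K, ℂ) →L[ℂ] Lp ℂ 2 μ) :=
    ContinuousMap.toLp_denseRange _ _ _ (by simp)
  have hb : ∃ C, ∀ x, ‖φ.toLinearMap x‖ ≤
      C * ‖(ContinuousMap.toLp 2 μ ℂ : C(K, ℂ) →L[ℂ] Lp ℂ 2 μ).toLinearMap x‖ := by
    refine ⟨(μ Set.univ ^ (1 / (1 : ℝ≥0∞).toReal - 1 / (2 : ℝ≥0∞).toReal)).toReal, fun x => ?_⟩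
    have hx : AEStronglyMeasurable x μ := x.continuous.aestronglyMeasurable
    have e1 : ∫ t, ‖x t‖ ∂μ = (eLpNorm x 1 μ).toReal := by
      rw [integral_norm_eq_lintegral_enorm hx, eLpNorm_one_eq_lintegral_enorm]
    have e2 : ‖(ContinuousMap.toLp 2 μ ℂ : C(K, ℂ) →L[ℂ] Lp ℂ 2 μ) x‖ = (eLpNorm x 2 μ).toReal := by
      rw [Lp.norm_def, eLpNorm_congr_ae (ContinuousMap.coeFn_toLp (p := 2) (𝕜 := ℂ) μ x)]
    refine (hμ x).trans ?_
    rw [ContinuousLinearMap.coe_coe, e1, e2, mul_comm, ← ENNReal.toReal_mul]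
    refine ENNReal.toReal_mono ?_ (eLpNorm_le_eLpNorm_mul_rpow_measure_univ (by norm_num) hx)
    refine ENNReal.mul_ne_top ?_ (ENNReal.rpow_ne_top_of_nonneg (by norm_num) (measure_ne_top μ _))
    rw [← eLpNorm_congr_ae (ContinuousMap.coeFn_toLp (p := 2) (𝕜 := ℂ) μ x)]
    exact Lp.eLpNorm_ne_top _
  let ψ := φ.toLinearMap.extendOfNorm (ContinuousMap.toLp 2 μ ℂ : C(K, ℂ) →L[ℂ] Lp ℂ 2 μ).toLinearMap
  have hψ : ∀ g, ψ (ContinuousMap.toLp 2 μ ℂ g) = φ g := fun g => 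
    LinearMap.extendOfNorm_eq hd hb g
  let u := (InnerProductSpace.toDual ℂ (Lp ℂ 2 μ)).symm ψ
  have hu : ∀ x, inner ℂ u x = ψ x := fun x => InnerProductSpace.toDual_symm_apply
  have hus : AEStronglyMeasurable (fun t => starRingEnd ℂ (u t)) μ :=
    Complex.continuous_conj.comp_aestronglyMeasurable (Lp.aestronglyMeasurable u)
  have hui : Integrable (fun t => starRingEnd ℂ (u t)) μ := by
    have h1 : Integrable u μ := (Lp.memLp u).integrable (by norm_num)
    refine h1.norm.mono' hus (ae_of_all _ fun t => ?_)
    simp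
  refine ⟨μ, hus.mk _, hfin, hreg, hus.stronglyMeasurable_mk.measurable, hui.congr hus.ae_eq_mk, 
    fun g => ?_⟩
  rw [← hψ, ← hu, L2.inner_def]
  apply integral_congr_ae
  filter_upwards [hus.ae_eq_mk, ContinuousMap.coeFn_toLp (p := 2) (𝕜 := ℂ) μ g] with t h1 h2
  rw [h2, ← h1]
  simp

lemma riesz_polar (φ : C(K, ℂ) →L[ℂ] ℂ) :
    ∃ (μ : Measure K) (w : K → ℂ), IsFiniteMeasure μ ∧ μ.Regular ∧ Measurable w ∧ 
      (∀ t, ‖w t‖ = 1) ∧ ∀ g : C(K, ℂ), φ g = ∫ t, g t * w t ∂μ := by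
  obtain ⟨μ, v, hfin, hreg, hv, hvi, h⟩ := exists_density φ
  have hfi : ∫⁻ t, (‖v t‖₊ : ℝ≥0∞) ∂μ ≠ ∞ := hvi.hasFiniteIntegral.ne
  refine ⟨μ.withDensity (fun t => (‖v t‖₊ : ℝ≥0∞)), fun t => if v t = 0 then 1 else v t / ‖v t‖, 
    isFiniteMeasure_withDensity hfi, regular_withDensity μ _ hfi, ?_, ?_, ?_⟩
  · exact Measurable.ite (hv (measurableSet_singleton 0)) measurable_const
      (hv.div (by fun_prop))
  · intro t
    by_cases h0 : v t = 0 <;> simp [h0]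
  · intro g
    rw [h, integral_withDensity_eq_integral_smul hv.nnnorm]
    congr 1
    ext t
    by_cases h0 : v t = 0
    · simp [h0]
    · have : (‖v t‖ : ℂ) ≠ 0 := by simpa using h0
      simp only [h0, if_false, NNReal.smul_def, coe_nnnorm, Complex.real_smul]
      field_simp
end RieszPart

/-- Every orthogonally additive continuous `k`-homogeneous polynomial `P` on
`C(K)` is represented by a complex regular Borel measure on `K` (encoded in
polar form `w · μ` with `μ` finite positive regular and `w` unimodular):
`P x = ∫_K x(t)^k dμ(t)`. -/
theorem orthAdd_homogPoly_repr
    {K : Type*} [TopologicalSpace K] [CompactSpace K] [T2Space K]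
    [MeasurableSpace K] [BorelSpace K]
    (k : ℕ) (hk : 1 ≤ k) (P : C(K, ℂ) → ℂ)
    (hP : IsHomogPoly k P) (hOA : IsOrthAdd P) :
    ∃ (μ : Measure K) (w : K → ℂ),
      IsFiniteMeasure μ ∧ μ.Regular ∧ Measurable w ∧ (∀ t, ‖w t‖ = 1) ∧
      ∀ x : C(K, ℂ), P x = ∫ t, (x t) ^ k * w t ∂μ := by
  obtain ⟨φ, hφ⟩ := exists_functional hk hP hOA
  obtain ⟨μ, w, h1, h2, h3, h4, h5⟩ := riesz_polar φ
  refine ⟨μ, w, h1, h2, h3, h4, fun x => ?_⟩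
  rw [hφ, h5]
  simp
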